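/- Fix a real number α with 1/2 < α < 1 and set t = α²/(α² + (1-α)²). There exist a constant C > 0 and N such that for every integer n ≥ N, every tree T* on n vertices maximizing Ψ(T,α) = αλ₁(T) + (1-α)λ₂(T) over all trees T on n vertices satisfies |λ₁(T*) - √(t(n-1))| ≤ C/√n and |λ₂(T*) - √((1-t)(n-1))| ≤ C/√n. -/

import Mathlib

open scoped Classical

/-- Adjacency matrix of a simple graph on `Fin n`, over `ℝ`. -/
noncomputable def adjMat {n : ℕ} (G : SimpleGraph (Fin n)) : Matrix (Fin n) (Fin n) ℝ :=
  fun i j => if G.Adj i j then 1 else 0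

/-- The eigenvalues (roots of the characteristic polynomial, with multiplicity)
of the adjacency matrix, sorted in nondecreasing order. -/
noncomputable def eigList {n : ℕ} (G : SimpleGraph (Fin n)) : List ℝ :=
  (Matrix.charpoly (adjMat G)).roots.sort (· ≤ ·)

/-- `lam k G` is the `k`-th largest adjacency eigenvalue of `G` (so `lam 1` is `λ₁`). -/
noncomputable def lam {n : ℕ} (k : ℕ) (G : SimpleGraph (Fin n)) : ℝ :=
  (eigList G).getD (n - k) 0

/-- The double comet `DC(k1, k2, l)`: a path on `l` vertices (the vertices `0, …, l-1`),
with `k1` pendant leaves attached to the terminal vertex `0` and `k2` pendant leaves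
attached to the terminal vertex `l - 1`. -/
def doubleComet (k1 k2 l : ℕ) : SimpleGraph (Fin (k1 + k2 + l)) :=
  SimpleGraph.fromRel (fun i j =>
    ((i : ℕ) + 1 = (j : ℕ) ∧ (j : ℕ) < l) ∨
    (l ≤ (i : ℕ) ∧ (i : ℕ) < l + k1 ∧ (j : ℕ) = 0) ∨
    (l + k1 ≤ (i : ℕ) ∧ (j : ℕ) = l - 1))

/-- Degree of a vertex. -/
noncomputable def deg {n : ℕ} (G : SimpleGraph (Fin n)) (u : Fin n) : ℕ :=
  (Finset.univ.filter (fun w => G.Adj u w)).card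

theorem adjMat_isHermitian {n : ℕ} (G : SimpleGraph (Fin n)) : (adjMat G).IsHermitian := by
  ext i j
  simp [adjMat, Matrix.conjTranspose_apply, G.adj_comm]

theorem eigList_length {n : ℕ} (G : SimpleGraph (Fin n)) : (eigList G).length = n := by
  unfold eigList
  rw [Multiset.length_sort, (adjMat_isHermitian G).roots_charpoly_eq_eigenvalues]
  simp

theorem eigList_sorted {n : ℕ} (G : SimpleGraph (Fin n)) : (eigList G).Pairwise (· ≤ ·) :=
  Multiset.pairwise_sort _ _

theorem adj_trace {n : ℕ} (G : SimpleGraph (Fin n)) (hG : G.IsTree) :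
    (adjMat G * adjMat G).trace = 2 * ((n : ℝ) - 1) := by
  have h1 := hG.card_edgeFinset
  have h2 := G.sum_degrees_eq_twice_card_edges
  have h3 : (adjMat G * adjMat G).trace = ((∑ v, G.degree v : ℕ) : ℝ) := by
    simp only [Matrix.trace, Matrix.diag, Matrix.mul_apply, adjMat]
    push_cast
    refine Finset.sum_congr rfl fun i _ => ?_
    have : ∀ j, (if G.Adj i j then (1:ℝ) else 0) * (if G.Adj j i then (1:ℝ) else 0)
        = if G.Adj i j then 1 else 0 := by
      intro j
      by_cases h : G.Adj i j
      · simp [h, h.symm]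
      · simp [h]
    simp only [this]
    rw [Finset.sum_boole, ← SimpleGraph.card_neighborFinset_eq_degree,
      SimpleGraph.neighborFinset_eq_filter]
  rw [h3, h2]
  rw [Fintype.card_fin] at h1
  have : ((G.edgeFinset.card : ℕ) : ℝ) + 1 = n := by exact_mod_cast h1
  push_cast
  linarith

theorem eig_sum_sq {n : ℕ} (G : SimpleGraph (Fin n)) :
    ((eigList G).map (fun x => x ^ 2)).sum = (adjMat G * adjMat G).trace := by
  have hA := adjMat_isHermitian G
  have h1 : ((eigList G).map (fun x => x ^ 2)).sum = ∑ i, hA.eigenvalues i ^ 2 := by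
    rw [← Multiset.sum_coe, ← Multiset.map_coe]
    unfold eigList
    rw [Multiset.sort_eq, hA.roots_charpoly_eq_eigenvalues]
    simp [List.sum_ofFn]
  rw [h1]
  conv_rhs => rw [hA.spectral_theorem, ← map_mul]
  rw [Unitary.conjStarAlgAut_apply, Matrix.trace_mul_comm, ← mul_assoc]
  simp [Matrix.diagonal_mul_diagonal, Matrix.trace_diagonal, pow_two]

theorem charpoly_neg_aux {n : ℕ} (A : Matrix (Fin n) (Fin n) ℝ) :
    (-A).charpoly = Polynomial.C ((-1) ^ n) * A.charpoly.comp (-Polynomial.X) := by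
  refine Polynomial.funext fun r => ?_
  simp only [Polynomial.eval_mul, Polynomial.eval_C, Polynomial.eval_comp, Polynomial.eval_neg,
    Polynomial.eval_X, Matrix.eval_charpoly]
  have := Matrix.det_neg (Matrix.scalar (Fin n) (-r) - A)
  rw [Fintype.card_fin] at this
  rw [← this]
  congr 1
  simp [add_comm, sub_eq_add_neg]

theorem charpoly_neg_tree {n : ℕ} (G : SimpleGraph (Fin n)) (hG : G.IsTree) :
    (-adjMat G).charpoly = (adjMat G).charpoly := by
  obtain ⟨c⟩ := hG.colorable_two
  let s : Fin n → ℝ := fun i => if c i = 0 then 1 else -1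
  have hs : ∀ i, s i * s i = 1 := by intro i; simp only [s]; split_ifs <;> norm_num
  have hD : Matrix.diagonal s * Matrix.diagonal s = 1 := by
    rw [Matrix.diagonal_mul_diagonal]
    simp [hs]
  have hc : -adjMat G = Matrix.diagonal s * (adjMat G * Matrix.diagonal s) := by
    ext i j
    rw [Matrix.diagonal_mul, Matrix.mul_diagonal, Matrix.neg_apply]
    simp only [adjMat]
    by_cases h : G.Adj i j
    · have := c.valid h
      simp only [h, if_true, s]
      have h1 : c i = 0 ∨ c i = 1 := by omega
      have h2 : c j = 0 ∨ c j = 1 := by omega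
      rcases h1 with h1 | h1 <;> rcases h2 with h2 | h2 <;> simp_all
    · simp [h]
  rw [hc, Matrix.charpoly_mul_comm, mul_assoc, hD, mul_one]

theorem eigList_symm {n : ℕ} (G : SimpleGraph (Fin n)) (hG : G.IsTree) :
    ((eigList G).map (fun x => -x)).reverse = eigList G := by
  have hr : (adjMat G).charpoly.roots.map (fun x => -x) = (adjMat G).charpoly.roots := by
    conv_rhs => rw [← charpoly_neg_tree G hG, charpoly_neg_aux]
    rw [Polynomial.roots_C_mul _ (by positivity), Polynomial.roots_comp_neg_X]
  apply List.Perm.eq_of_pairwise' (r := (· ≤ ·))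
  · rw [List.pairwise_reverse, List.pairwise_map]
    exact (eigList_sorted G).imp (by intro a b h; linarith)
  · exact eigList_sorted G
  · refine (List.reverse_perm _).trans ?_
    rw [← Multiset.coe_eq_coe, ← Multiset.map_coe]
    unfold eigList
    rw [Multiset.sort_eq, hr]

theorem lam_upper {n : ℕ} (hn : 4 ≤ n) (G : SimpleGraph (Fin n)) (hG : G.IsTree) :
    lam 1 G ^ 2 + lam 2 G ^ 2 ≤ (n : ℝ) - 1 := by
  have hlen := eigList_length G
  have hsum : ∑ i : Fin n, (eigList G).getD i 0 ^ 2 = 2 * ((n : ℝ) - 1) := by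
    rw [← adj_trace G hG, ← eig_sum_sq]
    have : (eigList G).map (fun x => x ^ 2)
        = List.ofFn (fun i : Fin n => (eigList G).getD i 0 ^ 2) := by
      apply List.ext_getElem
      · simp [hlen]
      · intro i h1 h2
        simp only [List.length_map] at h1
        simp [h1]
    rw [this, List.sum_ofFn]
  have hsym : ∀ i, i < n → (eigList G).getD (n - 1 - i) 0 = - (eigList G).getD i 0 := by
    intro i hi
    have h0 : i < (eigList G).length := by omega
    have h1 : n - 1 - i < (eigList G).length := by omega
    conv_lhs => rw [← eigList_symm G hG]
    rw [List.getD_eq_getElem _ _ (by simpa using h1), List.getElem_reverse,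
      List.getD_eq_getElem _ _ h0]
    simp only [List.getElem_map, List.length_map, neg_inj]
    congr 1
    omega
  have a0 := hsym 0 (by omega)
  have a1 := hsym 1 (by omega)
  have e1 : n - 1 - 0 = n - 1 := by omega
  have e2 : n - 1 - 1 = n - 2 := by omega
  rw [e1] at a0
  rw [e2] at a1
  unfold lam
  have hle : ∑ i ∈ ({⟨0, by omega⟩, ⟨1, by omega⟩, ⟨n-1, by omega⟩, ⟨n-2, by omega⟩} : Finset (Fin n)),
      (eigList G).getD i 0 ^ 2 ≤ ∑ i : Fin n, (eigList G).getD i 0 ^ 2 :=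
    Finset.sum_le_sum_of_subset_of_nonneg (Finset.subset_univ _) (fun _ _ _ => sq_nonneg _)
  rw [hsum, Finset.sum_insert, Finset.sum_insert, Finset.sum_insert, Finset.sum_singleton] at hle
  · simp only [a0, a1] at hle ⊢
    nlinarith
  · simp; omega
  · simp; omega
  · simp; omega

theorem lam_lower {n : ℕ} (G : SimpleGraph (Fin n)) (x y : ℝ) (hxy : y < x)
    (v w : Fin n → ℝ) (hv : v ≠ 0) (hw : w ≠ 0)
    (hxv : (adjMat G).mulVec v = x • v) (hyw : (adjMat G).mulVec w = y • w) :
    x ≤ lam 1 G ∧ y ≤ lam 2 G := by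
  have key : ∀ (x : ℝ) (v : Fin n → ℝ), v ≠ 0 → (adjMat G).mulVec v = x • v → x ∈ eigList G := by
    intro x v hv h
    unfold eigList
    rw [Multiset.mem_sort, Polynomial.mem_roots (Matrix.charpoly_monic _).ne_zero,
      Polynomial.IsRoot, Matrix.eval_charpoly]
    rw [← Matrix.exists_mulVec_eq_zero_iff]
    refine ⟨v, hv, ?_⟩
    rw [Matrix.sub_mulVec, h]
    ext i
    simp [Matrix.scalar_apply]
  have hx := key x v hv hxv
  have hy := key y w hw hyw
  have hlen := eigList_length G
  have hsort := List.pairwise_iff_getElem.1 (eigList_sorted G)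
  obtain ⟨i, hi, rfl⟩ := List.getElem_of_mem hx
  obtain ⟨j, hj, rfl⟩ := List.getElem_of_mem hy
  have hm : ∀ i j (hi : i < (eigList G).length) (hj : j < (eigList G).length), i ≤ j →
      (eigList G)[i] ≤ (eigList G)[j] := by
    intro i j hi hj hij
    rcases hij.eq_or_lt with rfl | h
    · exact le_rfl
    · exact hsort i j hi hj h
  have hji : j < i := by
    by_contra h
    exact absurd (hm i j hi hj (by omega)) (by linarith)
  unfold lam
  rw [List.getD_eq_getElem _ _ (by omega), List.getD_eq_getElem _ _ (by omega)]
  exact ⟨hm _ _ _ _ (by omega), hm _ _ _ _ (by omega)⟩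

/-- The double star with centres `0` and `1`: the vertices `2, …, k+1` are leaves at `0`, the
remaining ones are leaves at `1`. -/
def dstar (n k : ℕ) : SimpleGraph (Fin n) :=
  SimpleGraph.fromRel (fun i j => (i : ℕ) ≠ 0 ∧ (j : ℕ) = if (i : ℕ) < k + 2 then 0 else 1)

theorem dstar_adj {n k : ℕ} (i j : Fin n) : (dstar n k).Adj i j ↔
    (i : ℕ) ≠ j ∧ (((i : ℕ) ≠ 0 ∧ (j : ℕ) = if (i : ℕ) < k + 2 then 0 else 1) ∨
      ((j : ℕ) ≠ 0 ∧ (i : ℕ) = if (j : ℕ) < k + 2 then 0 else 1)) := by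
  unfold dstar
  rw [SimpleGraph.fromRel_adj, Ne, Fin.ext_iff]

theorem dstar_isTree {n k : ℕ} (hn : 2 ≤ n) : (dstar n k).IsTree := by
  let z : Fin n := ⟨0, by omega⟩
  let o : Fin n := ⟨1, by omega⟩
  have h01 : (dstar n k).Adj o z := by
    rw [dstar_adj]; simp [o, z]
  have hreach : ∀ i : Fin n, (dstar n k).Reachable i z := by
    intro i
    by_cases h0 : (i : ℕ) = 0
    · have : i = z := Fin.ext h0
      rw [this]
    by_cases h1 : (i : ℕ) < k + 2
    · apply SimpleGraph.Adj.reachable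
      rw [dstar_adj]; simp [z, h0, h1]
    · refine SimpleGraph.Reachable.trans (SimpleGraph.Adj.reachable (v := o) ?_) h01.reachable
      rw [dstar_adj]
      refine ⟨by simp only [o]; omega, Or.inl ⟨h0, ?_⟩⟩
      simp [o, h1]
  have hconn : (dstar n k).Connected :=
    { preconnected := fun i j => (hreach i).trans (hreach j).symm
      nonempty := ⟨z⟩ }
  rw [SimpleGraph.isTree_iff_connected_and_card]
  refine ⟨hconn, le_antisymm ?_ ?_⟩
  · rw [Nat.card_eq_fintype_card, ← SimpleGraph.edgeFinset_card]
    let p : Fin n → Fin n := fun i => if (i : ℕ) < k + 2 then z else o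
    have hsub : (dstar n k).edgeFinset ⊆ (Finset.univ.erase z).image (fun i => s(i, p i)) := by
      intro e he
      induction e using Sym2.ind with
      | _ a b =>
        rw [SimpleGraph.mem_edgeFinset, SimpleGraph.mem_edgeSet, dstar_adj] at he
        rw [Finset.mem_image]
        have hp : ∀ i j : Fin n, (j : ℕ) = (if (i : ℕ) < k + 2 then 0 else 1) → p i = j := by
          intro i j h
          apply Fin.ext
          rw [h]
          simp only [p]
          split_ifs <;> rfl
        rcases he with ⟨_, ⟨h1, h2⟩ | ⟨h1, h2⟩⟩
        · refine ⟨a, ?_, ?_⟩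
          · simp [z, Fin.ext_iff, h1]
          · rw [hp a b h2]
        · refine ⟨b, ?_, ?_⟩
          · simp [z, Fin.ext_iff, h1]
          · rw [hp b a h2, Sym2.eq_swap]
    have h1 := (Finset.card_le_card hsub).trans Finset.card_image_le
    rw [Finset.card_erase_of_mem (Finset.mem_univ _), Finset.card_univ, Fintype.card_fin] at h1
    rw [Nat.card_eq_fintype_card, Fintype.card_fin]
    omega
  · exact hconn.card_vert_le_card_edgeSet_add_one

theorem range_sum_aux (k l : ℕ) (f : ℕ → ℝ) (c d : ℝ) (hc : ∀ j < k, f (j + 2) = c)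
    (hd : ∀ j < l, f (k + j + 2) = d) :
    ∑ j ∈ Finset.range (k + l + 2), f j = f 0 + f 1 + k * c + l * d := by
  rw [Finset.sum_range_succ', Finset.sum_range_succ', Finset.sum_range_add]
  have e1 : ∑ x ∈ Finset.range k, f (x + 1 + 1) = k * c := by
    rw [Finset.sum_congr rfl (fun j hj => hc j (Finset.mem_range.1 hj))]
    simp
  have e2 : ∑ x ∈ Finset.range l, f (k + x + 1 + 1) = l * d := by
    rw [Finset.sum_congr rfl (fun j hj => hd j (Finset.mem_range.1 hj))]
    simp
  rw [e1, e2]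
  ring

theorem dstar_eig (k l : ℕ) (x : ℝ) (hx : 0 < x) (h : (x ^ 2 - k) * (x ^ 2 - l) = x ^ 2) :
    ∃ v : Fin (k + l + 2) → ℝ, v ≠ 0 ∧ (adjMat (dstar (k + l + 2) k)).mulVec v = x • v := by
  let V : ℕ → ℝ := fun i => if i = 0 then x ^ 2 else if i = 1 then x * (x ^ 2 - k) else
    if i < k + 2 then x else x ^ 2 - k
  refine ⟨fun i => V i, ?_, ?_⟩
  · intro h0
    have := congrFun h0 ⟨0, by omega⟩
    simp [V] at this
    linarith
  · ext i
    simp only [Matrix.mulVec, dotProduct, adjMat, dstar_adj, Pi.smul_apply, smul_eq_mul]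
    rw [Fin.sum_univ_eq_sum_range (fun j => (if (i : ℕ) ≠ j ∧
      (((i : ℕ) ≠ 0 ∧ j = if (i : ℕ) < k + 2 then 0 else 1) ∨
      (j ≠ 0 ∧ (i : ℕ) = if j < k + 2 then 0 else 1)) then (1 : ℝ) else 0) * V j)]
    obtain ⟨i, hi⟩ := i
    simp only
    by_cases i0 : i = 0
    · subst i0
      rw [range_sum_aux k l _ x 0]
      · simp [V]; ring
      · intro j hj; simp [V, hj]
      · intro j hj; simp
    by_cases i1 : i = 1
    · subst i1
      rw [range_sum_aux k l _ 0 (x ^ 2 - k)]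
      · simp [V]; linear_combination -h
      · intro j hj; simp [hj]
      · intro j hj; simp [V]
    by_cases i2 : i < k + 2
    · rw [range_sum_aux k l _ 0 0]
      · simp [V, i0, i1, i2]; ring
      · intro j hj; simp [i0, i2, hj]
      · intro j hj; simp [i0, i1, i2]
    · rw [range_sum_aux k l _ 0 0]
      · simp [V, i0, i1, i2]; try ring
      · intro j hj; simp [i0, i2, hj]
      · intro j hj; simp [i0, i1, i2]

theorem dstar_lam (k l : ℕ) (w : ℝ) (hw : ((k : ℝ) + l + 1) / 2 < w) (hw2 : w < (k : ℝ) + l + 1)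
    (h : w * ((k : ℝ) + l + 1 - w) = k * l) :
    √w ≤ lam 1 (dstar (k + l + 2) k) ∧ √((k : ℝ) + l + 1 - w) ≤ lam 2 (dstar (k + l + 2) k) := by
  have hk : (0 : ℝ) ≤ k := Nat.cast_nonneg k
  have hl : (0 : ℝ) ≤ l := Nat.cast_nonneg l
  have hw0 : 0 < w := by linarith
  have hw1 : 0 < (k : ℝ) + l + 1 - w := by linarith
  obtain ⟨v, hv, hv'⟩ := dstar_eig k l (√w) (Real.sqrt_pos.2 hw0)
    (by rw [Real.sq_sqrt hw0.le]; linear_combination -h)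
  obtain ⟨u, hu, hu'⟩ := dstar_eig k l (√((k : ℝ) + l + 1 - w)) (Real.sqrt_pos.2 hw1)
    (by rw [Real.sq_sqrt hw1.le]; linear_combination -h)
  exact lam_lower _ _ _ (Real.sqrt_lt_sqrt hw1.le (by linarith)) v u hv hu hv' hu'

/-- Choice of the parameters of the double star. -/
theorem choose_param (t : ℝ) (ht : 1 / 2 < t) (ht1 : t < 1) (n : ℕ) (hn : 1 / t + 1 ≤ n)
    (hn2 : 2 / (1 - t) + 1 ≤ n) :
    ∃ k l : ℕ, k + l + 2 = n ∧ ∃ w : ℝ, ((n : ℝ) - 1) / 2 < w ∧ w < (n : ℝ) - 1 ∧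
      w * ((n : ℝ) - 1 - w) = k * l ∧ |w - t * ((n : ℝ) - 1)| ≤ 1 / (t - 1 / 2) := by
  have ht0 : 0 < t := by linarith
  have ht2 : 0 < 1 - t := by linarith
  obtain ⟨m, rfl⟩ : ∃ m, n = m + 1 := by
    have : (1 : ℝ) ≤ n := by have : 0 < 1 / t := by positivity
                             linarith
    have : 1 ≤ n := by exact_mod_cast this
    exact ⟨n - 1, by omega⟩
  push_cast at hn hn2 ⊢
  have hs1 : 1 ≤ t * m := by
    have : 1 / t ≤ m := by linarith
    rw [div_le_iff₀ ht0] at this; linarith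
  have hs2 : 2 ≤ (1 - t) * m := by
    have : 2 / (1 - t) ≤ m := by linarith
    rw [div_le_iff₀ ht2] at this; linarith
  have hm : (0 : ℝ) < m := by nlinarith
  obtain ⟨k, hk1, hk2⟩ : ∃ k : ℕ, (k : ℝ) ≤ t * m ∧ t * m < k + 1 :=
    ⟨⌊t * m⌋₊, Nat.floor_le (by linarith), Nat.lt_floor_add_one _⟩
  have hkpos : (0 : ℝ) < k := by
    have : k ≠ 0 := by rintro rfl; norm_num at hk2; linarith
    exact_mod_cast Nat.pos_of_ne_zero this
  have hkm : k + 2 ≤ m := by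
    have : (k : ℝ) + 2 ≤ m := by linarith
    exact_mod_cast this
  obtain ⟨l, rfl⟩ : ∃ l, m = k + l + 1 := ⟨m - k - 1, by omega⟩
  have hlpos : (0 : ℝ) < l := by
    have : 0 < l := by omega
    exact_mod_cast this
  push_cast at *
  have hm' : ∃ m : ℝ, (k : ℝ) + l + 1 = m := ⟨_, rfl⟩
  obtain ⟨m, hme⟩ := hm'
  have hle : (l : ℝ) = m - k - 1 := by linarith
  simp only [add_sub_cancel_right]
  rw [hme] at hs1 hs2 hm hk1 hk2 ⊢
  refine ⟨k, l, rfl, (m + √(m ^ 2 - 4 * (k * l))) / 2, ?_⟩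
  have hd : 0 < m ^ 2 - 4 * (k * l) := by
    rw [← hme]; nlinarith [sq_nonneg ((k : ℝ) - l)]
  have hr := Real.sq_sqrt hd.le
  have hr0 := Real.sqrt_pos.2 hd
  have hrm : √(m ^ 2 - 4 * (k * l)) < m := by
    rw [Real.sqrt_lt' hm]; nlinarith [mul_pos hkpos hlpos]
  set r := √(m ^ 2 - 4 * (k * l)) with hrdef
  refine ⟨by linarith, by linarith, by nlinarith, ?_⟩
  have hprod : ((m + r) / 2 - t * m) * ((m + r) / 2 + t * m - m)
      = t * m * (m - t * m) - k * l := by nlinarith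
  have hlow : (t - 1 / 2) * m ≤ (m + r) / 2 + t * m - m := by linarith
  have hbd0 : 0 ≤ t * m * (m - t * m) - k * l := by
    rw [hle]; nlinarith [mul_nonneg (sub_nonneg.2 hk1) (sub_nonneg.2 hk2.le)]
  have hbd1 : t * m * (m - t * m) - k * l ≤ m := by
    rw [hle]
    nlinarith [mul_nonneg (sub_nonneg.2 hk1) (sub_nonneg.2 hk2.le)]
  have hpos : 0 < (t - 1 / 2) * m := mul_pos (by linarith) hm
  have hnn : 0 ≤ (m + r) / 2 - t * m := by
    by_contra hneg
    push Not at hneg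
    nlinarith
  rw [abs_of_nonneg hnn, le_div_iff₀ (by linarith)]
  have : ((m + r) / 2 - t * m) * ((t - 1 / 2) * m) ≤ m :=
    (mul_le_mul_of_nonneg_left hlow hnn).trans (by rw [hprod]; exact hbd1)
  by_contra hcon
  push Not at hcon
  nlinarith

theorem sqrt_sub_sq (a b K : ℝ) (ha : 0 ≤ a) (hb : 0 < b) (h : |a - b| ≤ K) :
    (√a - √b) ^ 2 ≤ K ^ 2 / b := by
  rw [le_div_iff₀ hb]
  have h1 : (√a - √b) * (√a + √b) = a - b := by
    nlinarith [Real.sq_sqrt ha, Real.sq_sqrt hb.le]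
  have h2 : (a - b) ^ 2 ≤ K ^ 2 := sq_le_sq' (by linarith [(abs_le.1 h).1]) (abs_le.1 h).2
  have h3 : b ≤ (√a + √b) ^ 2 := by
    nlinarith [Real.sq_sqrt hb.le, Real.sqrt_nonneg a, Real.sqrt_nonneg b,
      mul_nonneg (Real.sqrt_nonneg a) (Real.sqrt_nonneg b)]
  calc (√a - √b) ^ 2 * b ≤ (√a - √b) ^ 2 * (√a + √b) ^ 2 :=
        mul_le_mul_of_nonneg_left h3 (sq_nonneg _)
    _ = (a - b) ^ 2 := by rw [← mul_pow, h1]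
    _ ≤ K ^ 2 := h2

/-- For fixed `1/2 < α < 1` with `t = α²/(α² + (1-α)²)`, there are `C > 0` and `N` such
that for all `n ≥ N`, every maximizer `T*` of `Ψ(·, α)` among trees on `n` vertices has
`λ₁(T*) ≈ √(t(n-1))` and `λ₂(T*) ≈ √((1-t)(n-1))` up to `C/√n`. -/
theorem psi_max_eigenvalue_estimates (α : ℝ) (hα0 : 1 / 2 < α) (hα1 : α < 1) :
    ∃ C : ℝ, 0 < C ∧ ∃ N : ℕ, ∀ n : ℕ, N ≤ n →
      ∀ Tstar : SimpleGraph (Fin n), Tstar.IsTree →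
        (∀ T : SimpleGraph (Fin n), T.IsTree →
          α * lam 1 T + (1 - α) * lam 2 T ≤
            α * lam 1 Tstar + (1 - α) * lam 2 Tstar) →
        |lam 1 Tstar -
            Real.sqrt ((α ^ 2 / (α ^ 2 + (1 - α) ^ 2)) * ((n : ℝ) - 1))| ≤
          C / Real.sqrt n ∧
        |lam 2 Tstar -
            Real.sqrt ((1 - α ^ 2 / (α ^ 2 + (1 - α) ^ 2)) * ((n : ℝ) - 1))| ≤
          C / Real.sqrt n := by
  have hq : 0 < α ^ 2 + (1 - α) ^ 2 := by positivity
  have hT1 : 1 / 2 < α ^ 2 / (α ^ 2 + (1 - α) ^ 2) := by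
    rw [lt_div_iff₀ hq]; nlinarith
  have hT2 : α ^ 2 / (α ^ 2 + (1 - α) ^ 2) < 1 := by
    rw [div_lt_one hq]; nlinarith
  have hTe : 1 - α ^ 2 / (α ^ 2 + (1 - α) ^ 2) = (1 - α) ^ 2 / (α ^ 2 + (1 - α) ^ 2) := by
    field_simp; ring
  have hA : α = √(α ^ 2 + (1 - α) ^ 2) * √(α ^ 2 / (α ^ 2 + (1 - α) ^ 2)) := by
    rw [← Real.sqrt_mul hq.le, mul_div_cancel₀ _ hq.ne', Real.sqrt_sq (by linarith)]
  have hB : 1 - α = √(α ^ 2 + (1 - α) ^ 2) * √(1 - α ^ 2 / (α ^ 2 + (1 - α) ^ 2)) := by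
    rw [hTe, ← Real.sqrt_mul hq.le, mul_div_cancel₀ _ hq.ne', Real.sqrt_sq (by linarith)]
  have hr : 0 < √(α ^ 2 + (1 - α) ^ 2) := Real.sqrt_pos.2 hq
  generalize √(α ^ 2 + (1 - α) ^ 2) = r at hA hB hr
  generalize α ^ 2 / (α ^ 2 + (1 - α) ^ 2) = t at *
  have ht0 : 0 < t := by linarith
  have ht1 : 0 < 1 - t := by linarith
  have hK : 0 < 1 / (t - 1 / 2) := by
    have : 0 < t - 1 / 2 := by linarith
    positivity
  generalize hKdef : 1 / (t - 1 / 2) = K at hK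
  obtain ⟨D, hD⟩ : ∃ D, D = K ^ 2 / t + K ^ 2 / (1 - t) := ⟨_, rfl⟩
  have hDpos : 0 < D := by rw [hD]; positivity
  refine ⟨√(2 * D), Real.sqrt_pos.2 (by linarith), max 4 (max ⌈1 / t + 1⌉₊ ⌈2 / (1 - t) + 1⌉₊), ?_⟩
  intro n hn Ts hTs hmax
  have hn4 : 4 ≤ n := (le_max_left _ _).trans hn
  have hn1 : 1 / t + 1 ≤ n := Nat.ceil_le.1
    ((le_max_left _ _).trans ((le_max_right _ _).trans hn))
  have hn2 : 2 / (1 - t) + 1 ≤ n := Nat.ceil_le.1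
    ((le_max_right _ _).trans ((le_max_right _ _).trans hn))
  obtain ⟨k, l, hkl, w, hw1, hw2, hw3, hw4⟩ := choose_param t hT1 hT2 n hn1 hn2
  rw [hKdef] at hw4
  have hmax' := hmax _ (dstar_isTree (k := k) (by omega))
  have hup := lam_upper hn4 Ts hTs
  have hn4' : (4 : ℝ) ≤ n := by exact_mod_cast hn4
  have hm : ∃ m : ℝ, (n : ℝ) - 1 = m := ⟨_, rfl⟩
  obtain ⟨m, hm⟩ := hm
  have hlow : √w ≤ lam 1 (dstar n k) ∧ √(m - w) ≤ lam 2 (dstar n k) := by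
    subst hkl
    push_cast at *
    have e : (k : ℝ) + l + 1 = m := by linarith
    have := dstar_lam k l w (by linarith) (by linarith) (by rw [← hw3]; ring)
    rwa [e] at this
  rw [hm] at hw1 hw2 hw3 hw4 hup ⊢
  have hm0 : 0 < m := by linarith
  generalize lam 1 Ts = p at *
  generalize lam 2 Ts = q at *
  generalize lam 1 (dstar n k) = x at *
  generalize lam 2 (dstar n k) = y at *
  -- the target vector
  have hX := Real.sq_sqrt (mul_pos ht0 hm0).le
  have hY := Real.sq_sqrt (mul_pos ht1 hm0).le
  have d1 := sqrt_sub_sq w (t * m) K (by linarith) (mul_pos ht0 hm0) hw4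
  have d2 := sqrt_sub_sq (m - w) ((1 - t) * m) K (by linarith) (mul_pos ht1 hm0)
    (by rw [← abs_neg]; convert hw4 using 2; ring)
  have hsum : K ^ 2 / (t * m) + K ^ 2 / ((1 - t) * m) = D / m := by
    rw [hD]; field_simp
  have hX' : √(t * m) = √t * √m := Real.sqrt_mul ht0.le _
  have hY' : √((1 - t) * m) = √(1 - t) * √m := Real.sqrt_mul ht1.le _
  have hw5 := Real.sq_sqrt (show 0 ≤ w by linarith)
  have hw6 := Real.sq_sqrt (show 0 ≤ m - w by linarith)
  have hcomp : x * √t + y * √(1 - t) ≤ p * √t + q * √(1 - t) := by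
    have : r * (x * √t + y * √(1 - t)) ≤ r * (p * √t + q * √(1 - t)) := by
      calc r * (x * √t + y * √(1 - t)) = (r * √t) * x + (r * √(1 - t)) * y := by ring
        _ = α * x + (1 - α) * y := by rw [← hA, ← hB]
        _ ≤ α * p + (1 - α) * q := hmax'
        _ = (r * √t) * p + (r * √(1 - t)) * q := by rw [← hA, ← hB]
        _ = _ := by ring
    exact le_of_mul_le_mul_left this hr
  have hcomp2 : √w * √(t * m) + √(m - w) * √((1 - t) * m)
      ≤ p * √(t * m) + q * √((1 - t) * m) := by
    have h1 : √w * √(t * m) ≤ x * √(t * m) :=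
      mul_le_mul_of_nonneg_right hlow.1 (Real.sqrt_nonneg _)
    have h2 : √(m - w) * √((1 - t) * m) ≤ y * √((1 - t) * m) :=
      mul_le_mul_of_nonneg_right hlow.2 (Real.sqrt_nonneg _)
    have h3 := mul_le_mul_of_nonneg_right hcomp (Real.sqrt_nonneg m)
    have h4 : x * √(t * m) + y * √((1 - t) * m) ≤ p * √(t * m) + q * √((1 - t) * m) := by
      rw [hX', hY']; linarith
    linarith
  have hfin : (p - √(t * m)) ^ 2 + (q - √((1 - t) * m)) ^ 2 ≤ D / m := by
    linarith
  have hDn : D / m ≤ 2 * D / n := by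
    rw [div_le_div_iff₀ hm0 (by linarith)]
    rw [mul_comm (2 * D) m, ← mul_assoc, mul_comm D]
    exact mul_le_mul_of_nonneg_right (by linarith) hDpos.le
  have key : ∀ a : ℝ, a ^ 2 ≤ D / m → |a| ≤ √(2 * D) / √n := by
    intro a ha
    rw [← Real.sqrt_div (by linarith)]
    exact Real.abs_le_sqrt (ha.trans hDn)
  exact ⟨key _ (by linarith [sq_nonneg (q - √((1 - t) * m))]),
    key _ (by linarith [sq_nonneg (p - √(t * m))])⟩
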